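/- Gelfand-type theorem for integrated groups: Let m ≥ n ≥ 0 be integers, E ≠ {0}, and suppose A generates an n-times integrated group bounded by M(1+|t|^m). Then σ(A) = {0} if and only if A^{m−n+1}x = 0 for every x ∈ D(A^{m−n+1}). -/

import Mathlib

open MeasureTheory Complex Filter Topology Metric

namespace SpectralDecomp

variable {G : Type*} [NormedAddCommGroup G] [NormedSpace ℂ G]

/-- `R` is the bounded inverse of `z • I - A`. -/
structure ResolventAt (A : G →ₗ.[ℂ] G) (z : ℂ) (R : G →L[ℂ] G) : Prop where
  mem : ∀ y : G, R y ∈ A.domain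
  solves : ∀ y : G, z • R y - A ⟨R y, mem y⟩ = y
  leftInv : ∀ x : A.domain, R (z • (x : G) - A x) = x

/-- The resolvent set of the (unbounded) operator `A`. -/
def resolventSet (A : G →ₗ.[ℂ] G) : Set ℂ :=
  {z : ℂ | ∃ R : G →L[ℂ] G, ResolventAt A z R}

/-- The spectrum of the (unbounded) operator `A`. -/
def spectrumSet (A : G →ₗ.[ℂ] G) : Set ℂ := (resolventSet A)ᶜ

/-- Membership in the domain of `A ^ j`. -/
def InDomPow (A : G →ₗ.[ℂ] G) : ℕ → G → Prop
  | 0, _ => True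
  | j + 1, x => ∃ h : x ∈ A.domain, InDomPow A j (A ⟨x, h⟩)

/-- The value `A ^ j x` for `x ∈ D(A ^ j)`. -/
noncomputable def powApply (A : G →ₗ.[ℂ] G) : (j : ℕ) → (x : G) → InDomPow A j x → G
  | 0, x, _ => x
  | j + 1, x, h => powApply A j (A ⟨x, h.choose⟩) h.choose_spec

/-- `A` generates an `n`-times integrated group `(Sp, Sm)` bounded by `M * (1 + |t| ^ m)`. -/
def Generates (A : G →ₗ.[ℂ] G) (n m : ℕ) (M : ℝ) (Sp Sm : ℝ → G →L[ℂ] G) : Prop :=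
  (∀ x : G, ContinuousOn (fun t : ℝ => Sp t x) (Set.Ici 0)) ∧
  (∀ x : G, ContinuousOn (fun t : ℝ => Sm t x) (Set.Ici 0)) ∧
  (∀ t : ℝ, 0 ≤ t → ‖Sp t‖ ≤ M * (1 + t ^ m)) ∧
  (∀ t : ℝ, 0 ≤ t → ‖Sm t‖ ≤ M * (1 + t ^ m)) ∧
  (∀ z : ℂ, 0 < z.re →
    (∃ R : G →L[ℂ] G, ResolventAt A z R ∧
      ∀ x : G, R x = z ^ n • ∫ t in Set.Ioi (0 : ℝ), Complex.exp (-z * t) • Sp t x) ∧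
    (∃ R : G →L[ℂ] G, ResolventAt A (-z) R ∧
      ∀ x : G, -(R x) = z ^ n • ∫ t in Set.Ioi (0 : ℝ), Complex.exp (-z * t) • Sm t x))

/-- The Riesz projection associated to the circle of centre `c` and radius `ρ`,
built from the resolvent function `Rres`. -/
noncomputable def rieszProj (Rres : ℂ → G →L[ℂ] G) (c : ℂ) (ρ : ℝ) : G →L[ℂ] G :=
  (2 * Real.pi * Complex.I)⁻¹ • (∮ z in C(c, ρ), Rres z)

theorem integral_pow_mul_exp_neg_mul (j : ℕ) {a : ℝ} (ha : 0 < a) :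
    ∫ t in Set.Ioi (0 : ℝ), t ^ j * Real.exp (-(a * t)) = j.factorial / a ^ (j + 1) := by
  have h := Real.integral_rpow_mul_exp_neg_mul_Ioi (a := j + 1) (r := a) (by positivity) ha
  rw [Real.Gamma_nat_eq_factorial, ← Nat.cast_succ, Real.rpow_natCast] at h
  simp only [Nat.succ_eq_add_one, Nat.cast_add, Nat.cast_one, add_sub_cancel_right,
    Real.rpow_natCast] at h
  rw [h, one_div, inv_pow, div_eq_inv_mul]

theorem integrableOn_pow_mul_exp_neg_mul (j : ℕ) {a : ℝ} (ha : 0 < a) :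
    IntegrableOn (fun t : ℝ => t ^ j * Real.exp (-(a * t))) (Set.Ioi 0) := by
  apply Integrable.of_integral_ne_zero
  rw [integral_pow_mul_exp_neg_mul j ha]
  positivity

theorem norm_laplace_le {E : Type*} [NormedAddCommGroup E] [NormedSpace ℂ E]
    {S : ℝ → E →L[ℂ] E} {m : ℕ} {M : ℝ} (hS : ∀ t : ℝ, 0 ≤ t → ‖S t‖ ≤ M * (1 + t ^ m))
    {z : ℂ} (hz : 0 < z.re) (x : E) :
    ‖∫ t in Set.Ioi (0 : ℝ), Complex.exp (-z * t) • S t x‖ ≤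
      M * (1 / z.re + m.factorial / z.re ^ (m + 1)) * ‖x‖ := by
  have h0 := integrableOn_pow_mul_exp_neg_mul 0 hz
  have hm := integrableOn_pow_mul_exp_neg_mul m hz
  have hint : ∫ t in Set.Ioi (0 : ℝ), M * ‖x‖ *
      (t ^ 0 * Real.exp (-(z.re * t)) + t ^ m * Real.exp (-(z.re * t))) =
      M * (1 / z.re + m.factorial / z.re ^ (m + 1)) * ‖x‖ := by
    rw [integral_const_mul, integral_add h0 hm, integral_pow_mul_exp_neg_mul 0 hz,
      integral_pow_mul_exp_neg_mul m hz]
    simp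
    ring
  rw [← hint]
  refine norm_integral_le_of_norm_le ((h0.add hm).const_mul _) ?_
  refine (ae_restrict_iff' measurableSet_Ioi).2 (Eventually.of_forall fun t ht => ?_)
  have ht0 : (0 : ℝ) ≤ t := le_of_lt ht
  have hexp : ‖Complex.exp (-z * t)‖ = Real.exp (-(z.re * t)) := by
    rw [Complex.norm_exp]; simp
  rw [norm_smul, hexp]
  calc Real.exp (-(z.re * t)) * ‖S t x‖
      ≤ Real.exp (-(z.re * t)) * (M * (1 + t ^ m) * ‖x‖) := by
        gcongr
        exact (S t).le_of_opNorm_le (hS t ht0) x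
    _ = _ := by ring

theorem norm_sq_add_norm_sq (z : ℂ) : ‖z ^ 2 + (‖z‖ : ℂ) ^ 2‖ = 2 * ‖z‖ * |z.re| := by
  have h : z ^ 2 + (‖z‖ : ℂ) ^ 2 = z * ((2 * z.re : ℝ) : ℂ) := by
    rw [← Complex.mul_conj', ← Complex.add_conj]
    ring
  rw [h, norm_mul, Complex.norm_real, Real.norm_eq_abs, abs_mul, abs_two]
  ring

theorem norm_damp_mul_le {n m : ℕ} {M : ℝ} (hM : 0 < M) {z : ℂ} {c q : ℝ} (hq : 0 ≤ q)
    (hz : 0 < |z.re|)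
    (hc : c ≤ ‖z‖ ^ n * (M * (1 / |z.re| + m.factorial / |z.re| ^ (m + 1)) * q)) :
    ‖z ^ 2 + (‖z‖ : ℂ) ^ 2‖ ^ (m + 1) * c ≤
      2 ^ (m + 1) * M * m.factorial * ‖z‖ ^ (m + 1 + n) * (1 + ‖z‖ ^ m) * q := by
  have hre : |z.re| ≤ ‖z‖ := Complex.abs_re_le_norm z
  have hf : (1 : ℝ) ≤ m.factorial := by exact_mod_cast Nat.succ_le_of_lt m.factorial_pos
  rw [norm_sq_add_norm_sq]
  calc (2 * ‖z‖ * |z.re|) ^ (m + 1) * c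
      ≤ (2 * ‖z‖ * |z.re|) ^ (m + 1) *
        (‖z‖ ^ n * (M * (1 / |z.re| + m.factorial / |z.re| ^ (m + 1)) * q)) := by gcongr
    _ = 2 ^ (m + 1) * M * ‖z‖ ^ (m + 1 + n) * (|z.re| ^ m + m.factorial) * q := by
        field_simp
        ring
    _ ≤ 2 ^ (m + 1) * M * ‖z‖ ^ (m + 1 + n) * (m.factorial * (1 + ‖z‖ ^ m)) * q := by
        gcongr
        have h1 : |z.re| ^ m ≤ ‖z‖ ^ m := by gcongr
        have h2 : (0 : ℝ) ≤ ‖z‖ ^ m := by positivity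
        nlinarith
    _ = _ := by ring

/-- A function holomorphic off the origin whose growth at the origin and at infinity is controlled
away from the imaginary axis is zero. -/
theorem eq_zero_of_damped_bounds {E : Type*} [NormedAddCommGroup E] [NormedSpace ℂ E]
    {g : ℂ → E} (hg : ∀ z ≠ 0, DifferentiableAt ℂ g z) (p : ℕ) {C : ℝ}
    (h0 : ∀ z : ℂ, z ≠ 0 → ‖z‖ ≤ 1 →
      ‖z ^ 2 + (‖z‖ : ℂ) ^ 2‖ ^ p * ‖g z‖ ≤ C * ‖z‖ ^ (2 * p))
    (hinf : ∀ z : ℂ, 2 ≤ ‖z‖ →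
      ‖z ^ 2 + (‖z‖ : ℂ) ^ 2‖ ^ p * (‖z‖ * ‖g z‖) ≤ C * ‖z‖ ^ (2 * p))
    {z : ℂ} (hz : z ≠ 0) : g z = 0 := by
  obtain ⟨u, rfl⟩ : ∃ u : ℂ, z = u ^ 2 := by
    obtain ⟨u, hu⟩ := IsAlgClosed.exists_pow_nat_eq z two_pos
    exact ⟨u, hu.symm⟩
  have hu : u ≠ 0 := by rintro rfl; simp at hz
  set ψ : ℝ → ℂ → E := fun ε v =>
    (v * ((v ^ 4 + (ε : ℂ) ^ 4) / v ^ 4) ^ p * (1 + (ε : ℂ) ^ 4 * v ^ 4) ^ p) • g (v ^ 2) with hψ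
  have hC : 0 ≤ C := by
    have := h0 1 one_ne_zero (by simp)
    simp only [norm_one, one_pow, mul_one] at this
    exact le_trans (by positivity) this
  have hbound : ∀ ε : ℝ, 0 < ε → ε < 1 / 2 → ε < ‖u‖ → ‖u‖ < ε⁻¹ → ‖ψ ε u‖ ≤ 2 ^ p * C * ε := by
    intro ε hε hε2 hεu huε
    set U : Set ℂ := ball 0 ε⁻¹ ∩ (closedBall 0 ε)ᶜ with hU
    have hclU : closure U ⊆ {v | v ≠ 0} := by
      intro v hv hv0
      have h1 : closure U ⊆ closure ((ball (0 : ℂ) ε)ᶜ) := closure_mono fun w hw =>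
        fun hw' => hw.2 (ball_subset_closedBall hw')
      rw [isOpen_ball.isClosed_compl.closure_eq] at h1
      exact h1 hv (by simp [hv0, hε])
    have hdiff : DiffContOnCl ℂ (ψ ε) U := by
      refine DifferentiableOn.diffContOnCl fun v hv => ?_
      have hv0 : v ≠ 0 := hclU hv
      have hg2 : DifferentiableAt ℂ (fun v => g (v ^ 2)) v :=
        (hg (v ^ 2) (pow_ne_zero 2 hv0)).comp v (differentiableAt_pow 2)
      refine (DifferentiableAt.smul ?_ hg2).differentiableWithinAt
      have : v ^ 4 ≠ 0 := pow_ne_zero 4 hv0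
      fun_prop (disch := assumption)
    have hsmall : ∀ v : ℂ, ‖v‖ = ε → ‖ψ ε v‖ ≤ 2 ^ p * C * ε := by
      intro v hv
      have hv0 : v ≠ 0 := by rintro rfl; simp at hv; linarith
      have h := h0 (v ^ 2) (pow_ne_zero 2 hv0) (by rw [norm_pow, hv]; nlinarith)
      have e1 : (v ^ 2) ^ 2 + ((‖v ^ 2‖ : ℝ) : ℂ) ^ 2 = v ^ 4 + (ε : ℂ) ^ 4 := by
        rw [norm_pow, hv]; push_cast; ring
      rw [e1, norm_pow, hv] at h
      have h2 : ‖1 + (ε : ℂ) ^ 4 * v ^ 4‖ ≤ 2 := by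
        refine (norm_add_le _ _).trans ?_
        have : ε ^ 4 * ε ^ 4 ≤ 1 := by
          rw [← pow_add]; exact pow_le_one₀ hε.le (by linarith)
        simp [hv, abs_of_pos hε]
        linarith
      simp only [hψ, norm_smul, norm_mul, norm_pow, norm_div, hv]
      rw [← pow_mul] at h
      calc ε * (‖v ^ 4 + (ε : ℂ) ^ 4‖ / ε ^ 4) ^ p * ‖1 + (ε : ℂ) ^ 4 * v ^ 4‖ ^ p * ‖g (v ^ 2)‖
          ≤ ε * (‖v ^ 4 + (ε : ℂ) ^ 4‖ / ε ^ 4) ^ p * 2 ^ p * ‖g (v ^ 2)‖ := by gcongr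
        _ = ε * 2 ^ p * (‖v ^ 4 + (ε : ℂ) ^ 4‖ ^ p * ‖g (v ^ 2)‖ / ε ^ (2 * (2 * p))) := by
            rw [div_pow, ← pow_mul, show 2 * (2 * p) = 4 * p by ring]; ring
        _ ≤ ε * 2 ^ p * (C * ε ^ (2 * (2 * p)) / ε ^ (2 * (2 * p))) := by gcongr
        _ = _ := by field_simp
    have hlarge : ∀ v : ℂ, ‖v‖ = ε⁻¹ → ‖ψ ε v‖ ≤ 2 ^ p * C * ε := by
      intro v hv
      have hε' : (2 : ℝ) ≤ ε⁻¹ := by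
        rw [le_inv_comm₀ (by norm_num) hε]; linarith
      have hv0 : v ≠ 0 := by rintro rfl; simp at hv; linarith
      have h := hinf (v ^ 2) (by rw [norm_pow, hv]; nlinarith)
      have hεC : (ε : ℂ) ≠ 0 := by exact_mod_cast hε.ne'
      have e1 : (v ^ 2) ^ 2 + ((‖v ^ 2‖ : ℝ) : ℂ) ^ 2 =
          ((ε : ℂ)⁻¹) ^ 4 * (1 + (ε : ℂ) ^ 4 * v ^ 4) := by
        rw [norm_pow, hv]; push_cast; field_simp; ring
      rw [e1, norm_mul, norm_pow, norm_inv, norm_pow v, hv, Complex.norm_real,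
        Real.norm_of_nonneg hε.le] at h
      have h2 : ‖v ^ 4 + (ε : ℂ) ^ 4‖ / ε⁻¹ ^ 4 ≤ 2 := by
        rw [div_le_iff₀ (by positivity)]
        refine (norm_add_le _ _).trans ?_
        have : ε ^ 4 ≤ ε⁻¹ ^ 4 := by gcongr; linarith
        rw [norm_pow, norm_pow, hv, Complex.norm_real, Real.norm_of_nonneg hε.le]
        linarith
      have h3 : ‖1 + (ε : ℂ) ^ 4 * v ^ 4‖ ^ p * (ε⁻¹ * ‖g (v ^ 2)‖) ≤ C * ε := by
        have hpos : 0 < ε⁻¹ ^ (4 * p) * ε⁻¹ := by positivity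
        refine le_of_mul_le_mul_left ?_ hpos
        calc _ = (ε⁻¹ ^ 4 * ‖1 + (ε : ℂ) ^ 4 * v ^ 4‖) ^ p * (ε⁻¹ ^ 2 * ‖g (v ^ 2)‖) := by ring
          _ ≤ C * (ε⁻¹ ^ 2) ^ (2 * p) := h
          _ = ε⁻¹ ^ (4 * p) * ε⁻¹ * (C * ε) := by
            rw [← pow_mul, show 2 * (2 * p) = 4 * p by ring]; field_simp
      simp only [hψ, norm_smul, norm_mul, norm_pow, norm_div, hv]
      calc ε⁻¹ * (‖v ^ 4 + (ε : ℂ) ^ 4‖ / ε⁻¹ ^ 4) ^ p * ‖1 + (ε : ℂ) ^ 4 * v ^ 4‖ ^ p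
            * ‖g (v ^ 2)‖
          ≤ ε⁻¹ * 2 ^ p * ‖1 + (ε : ℂ) ^ 4 * v ^ 4‖ ^ p * ‖g (v ^ 2)‖ := by gcongr
        _ = 2 ^ p * (‖1 + (ε : ℂ) ^ 4 * v ^ 4‖ ^ p * (ε⁻¹ * ‖g (v ^ 2)‖)) := by ring
        _ ≤ 2 ^ p * (C * ε) := by gcongr
        _ = _ := by ring
    refine Complex.norm_le_of_forall_mem_frontier_norm_le
      (isBounded_ball.subset Set.inter_subset_left) hdiff (fun v hv => ?_)
      (subset_closure ⟨by simpa using huε, by simpa using hεu⟩)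
    rcases frontier_inter_subset _ _ hv with h | h
    · exact hlarge v (by simpa using frontier_ball_subset_sphere h.1)
    · rw [frontier_compl] at h
      exact hsmall v (by simpa using frontier_closedBall_subset_sphere h.2)
  have hlim : Tendsto (fun ε : ℝ => ‖ψ ε u‖) (𝓝[>] 0) (𝓝 ‖u • g (u ^ 2)‖) := by
    have hcont : Continuous fun ε : ℝ => ‖ψ ε u‖ := by
      simp only [hψ]
      fun_prop
    have := (hcont.tendsto 0).mono_left (nhdsWithin_le_nhds (s := Set.Ioi 0))
    simpa [hψ, hu] using this
  have hlim0 : Tendsto (fun ε : ℝ => 2 ^ p * C * ε) (𝓝[>] 0) (𝓝 0) := by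
    have hcont : Continuous fun ε : ℝ => 2 ^ p * C * ε := by fun_prop
    simpa using (hcont.tendsto 0).mono_left (nhdsWithin_le_nhds (s := Set.Ioi 0))
  have hle : ‖u • g (u ^ 2)‖ ≤ 0 := by
    refine le_of_tendsto_of_tendsto hlim hlim0 ?_
    have hup : 0 < ‖u‖ := norm_pos_iff.2 hu
    have h1 : ∀ᶠ ε : ℝ in 𝓝[>] 0, ε < min (1 / 2) (min ‖u‖ ‖u‖⁻¹) :=
      nhdsWithin_le_nhds (Iio_mem_nhds (by positivity))
    filter_upwards [h1, self_mem_nhdsWithin] with ε h hε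
    simp only [lt_min_iff] at h
    exact hbound ε hε h.1 h.2.1 ((lt_inv_comm₀ hε hup).1 h.2.2)
  simpa [hu] using hle

section Resolvent

variable {A : G →ₗ.[ℂ] G} {z w : ℂ} {R S : G →L[ℂ] G}

theorem ResolventAt.apply_eq (hR : ResolventAt A z R) (y : G) :
    A ⟨R y, hR.mem y⟩ = z • R y - y := by
  rw [eq_sub_iff_add_eq, ← eq_sub_iff_add_eq', hR.solves]

theorem ResolventAt.sub_eq (hR : ResolventAt A z R) (hS : ResolventAt A w S) :
    R - S = (w - z) • (R * S) := by
  ext y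
  have h := hR.leftInv ⟨S y, hS.mem y⟩
  rw [hS.apply_eq] at h
  simp only [map_sub, map_smul] at h
  simp only [sub_apply, smul_apply, mul_apply_eq_comp, sub_smul]
  rw [← sub_eq_zero] at h ⊢
  rw [← h]
  abel

theorem ResolventAt.unique (hR : ResolventAt A z R) (hS : ResolventAt A z S) : R = S := by
  simpa [sub_eq_zero] using hR.sub_eq hS

theorem ResolventAt.commute (hR : ResolventAt A z R) (hS : ResolventAt A w S) :
    Commute R S := by
  rcases eq_or_ne w z with rfl | hwz
  · rw [hR.unique hS]
  · have h1 := hR.sub_eq hS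
    have h2 := hS.sub_eq hR
    have h3 : (w - z) • (R * S) = (w - z) • (S * R) := by
      rw [← h1, ← neg_sub S R, h2, ← neg_smul, neg_sub]
    exact smul_right_injective _ (sub_ne_zero.2 hwz) h3

theorem ResolventAt.injective (hR : ResolventAt A z R) : Function.Injective R := by
  refine (injective_iff_map_eq_zero R).2 fun y hy => ?_
  have h := hR.solves y
  have h0 : (⟨R y, hR.mem y⟩ : A.domain) = 0 := Subtype.ext hy
  rw [h0, hy] at h
  simpa using h.symm

/-- The resolvent is holomorphic on the resolvent set. -/
theorem ResolventAt.differentiableAt [CompleteSpace G] {Rz : ℂ → G →L[ℂ] G} {s : Set ℂ}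
    (hs : IsOpen s) (hRz : ∀ z ∈ s, ResolventAt A z (Rz z)) {z₀ : ℂ} (hz₀ : z₀ ∈ s) :
    DifferentiableAt ℂ Rz z₀ := by
  set B := Rz z₀
  have hB := hRz z₀ hz₀
  have hunit : ∀ z ∈ s, (1 - (z₀ - z) • B) * (1 + (z₀ - z) • Rz z) = 1 ∧
      (1 + (z₀ - z) • Rz z) * (1 - (z₀ - z) • B) = 1 := by
    intro z hz
    have h : Rz z - B = (z₀ - z) • (Rz z * B) := (hRz z hz).sub_eq hB
    have hc : Rz z * B = B * Rz z := ((hRz z hz).commute hB).eq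
    constructor
    · calc _ = 1 + (z₀ - z) • (Rz z - B - (z₀ - z) • (B * Rz z)) := by
            simp only [sub_mul, mul_add, one_mul, mul_one, smul_mul_assoc, mul_smul_comm, smul_sub]
            abel
        _ = 1 := by rw [← hc, h]; simp
    · calc _ = 1 + (z₀ - z) • (Rz z - B - (z₀ - z) • (Rz z * B)) := by
            simp only [mul_sub, add_mul, one_mul, mul_one, smul_mul_assoc, mul_smul_comm, smul_sub,
              smul_add]
            abel
        _ = 1 := by rw [h]; simp
  have hEq : ∀ z ∈ s, Rz z = Ring.inverse (1 - (z₀ - z) • B) * B := by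
    intro z hz
    obtain ⟨h1, h2⟩ := hunit z hz
    have hinv : Ring.inverse (1 - (z₀ - z) • B) = 1 + (z₀ - z) • Rz z :=
      Ring.inverse_unit ⟨_, _, h1, h2⟩
    rw [hinv, add_mul, one_mul, smul_mul_assoc, ← (hRz z hz).sub_eq hB]
    abel
  have hd : DifferentiableAt ℂ (fun z => Ring.inverse (1 - (z₀ - z) • B) * B) z₀ := by
    refine DifferentiableAt.mul_const ?_ _
    have hinner : DifferentiableAt ℂ (fun z : ℂ => 1 - (z₀ - z) • B) z₀ := by fun_prop
    refine DifferentiableAt.comp (g := Ring.inverse) z₀ (differentiableAt_inverse ?_) hinner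
    simp
  exact hd.congr_of_eventuallyEq (eventually_of_mem (hs.mem_nhds hz₀) hEq)

theorem ResolventAt.exists_powApply_pow (hR : ResolventAt A 1 R) (j : ℕ) (x v : G)
    (hv : v = (R ^ j) x) : ∃ h : InDomPow A j v, powApply A j v h = ((R - 1) ^ j) x := by
  induction j generalizing x v with
  | zero => exact ⟨trivial, by simpa [powApply] using hv⟩
  | succ j ih =>
    have hv' : v = R ((R ^ j) x) := by rw [hv, pow_succ']; rfl
    subst hv'
    have hA : A ⟨R ((R ^ j) x), hR.mem _⟩ = (R ^ j) ((R - 1) x) := by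
      have hc : R ((R ^ j) x) = (R ^ j) (R x) := by
        rw [← mul_apply_eq_comp, ← mul_apply_eq_comp,
          (Commute.self_pow R j).eq]
      rw [hR.apply_eq, one_smul, hc, sub_apply, map_sub]
      rfl
    obtain ⟨h, hp⟩ := ih ((R - 1) x) _ hA
    exact ⟨⟨hR.mem _, h⟩, by rw [pow_succ]; exact hp⟩

/-- The difference of `R(z) A ^ j x` and `z ^ j R(z) x` stays
bounded near the origin. -/
theorem exists_norm_resolvent_powApply_le {Rz : ℂ → G →L[ℂ] G}
    (hRz : ∀ z ≠ 0, ResolventAt A z (Rz z)) (j : ℕ) (x : G) (hx : InDomPow A j x) :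
    ∃ C : ℝ, 0 ≤ C ∧ ∀ z : ℂ, z ≠ 0 → ‖z‖ ≤ 1 →
      ‖Rz z (powApply A j x hx) - z ^ j • Rz z x‖ ≤ C := by
  induction j generalizing x with
  | zero => exact ⟨0, le_rfl, by simp [powApply]⟩
  | succ j ih =>
    obtain ⟨C, hC, h⟩ := ih _ hx.choose_spec
    refine ⟨C + ‖x‖, by positivity, fun z hz hz1 => ?_⟩
    have h1 := (hRz z hz).leftInv ⟨x, hx.choose⟩
    rw [map_sub, map_smul, sub_eq_iff_eq_add, ← sub_eq_iff_eq_add'] at h1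
    have h2 : Rz z (powApply A (j + 1) x hx) - z ^ (j + 1) • Rz z x =
        (Rz z (powApply A j (A ⟨x, hx.choose⟩) hx.choose_spec) -
          z ^ j • Rz z (A ⟨x, hx.choose⟩)) - z ^ j • x := by
      rw [← h1, smul_sub, smul_smul, ← pow_succ, powApply]
      abel
    rw [h2]
    refine (norm_sub_le _ _).trans (add_le_add (h z hz hz1) ?_)
    rw [norm_smul, norm_pow]
    exact mul_le_of_le_one_left (norm_nonneg _) (pow_le_one₀ (norm_nonneg _) hz1)

theorem norm_sq_add_norm_sq_le (z : ℂ) : ‖z ^ 2 + (‖z‖ : ℂ) ^ 2‖ ≤ 2 * ‖z‖ ^ 2 := by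
  refine (norm_add_le _ _).trans_eq ?_
  simp
  ring

/-- Multiplying the resolvent by powers of `R(1)` improves its decay at infinity. -/
theorem exists_damped_resolvent_mul_pow_le {Rz : ℂ → G →L[ℂ] G}
    (hRz : ∀ z ≠ 0, ResolventAt A z (Rz z)) {n m : ℕ} {K : ℝ} (hK : 0 ≤ K)
    (hb : ∀ z : ℂ, 2 ≤ ‖z‖ →
      ‖z ^ 2 + (‖z‖ : ℂ) ^ 2‖ ^ (m + 1) * ‖Rz z‖ ≤ K * ‖z‖ ^ (2 * m + 1 + n))
    (k : ℕ) (hk : k ≤ n) :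
    ∃ C : ℝ, 0 ≤ C ∧ ∀ z : ℂ, 2 ≤ ‖z‖ →
      ‖z ^ 2 + (‖z‖ : ℂ) ^ 2‖ ^ (m + 1) * (‖z‖ ^ k * ‖Rz z * Rz 1 ^ k‖) ≤
        C * ‖z‖ ^ (2 * m + 1 + n) := by
  induction k with
  | zero => exact ⟨K, hK, by simpa using hb⟩
  | succ k ih =>
    obtain ⟨C, hC, h⟩ := ih (by omega)
    refine ⟨2 * (C + 2 ^ (m + 1) * ‖Rz 1 ^ (k + 1)‖), by positivity, fun z hz => ?_⟩
    have hz0 : z ≠ 0 := by rintro rfl; norm_num at hz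
    have hid : (1 - z) • (Rz z * Rz 1 ^ (k + 1)) = Rz z * Rz 1 ^ k - Rz 1 ^ (k + 1) := by
      rw [pow_succ', ← mul_assoc, ← smul_mul_assoc, ← (hRz z hz0).sub_eq (hRz 1 one_ne_zero),
        sub_mul]
    have hz1 : ‖z‖ ≤ 2 * ‖1 - z‖ := by
      have := norm_sub_norm_le z 1
      rw [norm_sub_rev, norm_one] at this
      linarith
    set d := ‖z ^ 2 + (‖z‖ : ℂ) ^ 2‖
    have hd2 : d ≤ 2 * ‖z‖ ^ 2 := norm_sq_add_norm_sq_le z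
    have hstep : ‖z‖ * ‖Rz z * Rz 1 ^ (k + 1)‖ ≤ 2 * (‖Rz z * Rz 1 ^ k‖ + ‖Rz 1 ^ (k + 1)‖) := by
      calc ‖z‖ * ‖Rz z * Rz 1 ^ (k + 1)‖ ≤ 2 * ‖1 - z‖ * ‖Rz z * Rz 1 ^ (k + 1)‖ := by gcongr
        _ = 2 * ‖Rz z * Rz 1 ^ k - Rz 1 ^ (k + 1)‖ := by rw [← hid, norm_smul]; ring
        _ ≤ _ := by gcongr; exact norm_sub_le _ _
    calc d ^ (m + 1) * (‖z‖ ^ (k + 1) * ‖Rz z * Rz 1 ^ (k + 1)‖)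
        = d ^ (m + 1) * ‖z‖ ^ k * (‖z‖ * ‖Rz z * Rz 1 ^ (k + 1)‖) := by ring
      _ ≤ d ^ (m + 1) * ‖z‖ ^ k * (2 * (‖Rz z * Rz 1 ^ k‖ + ‖Rz 1 ^ (k + 1)‖)) := by gcongr
      _ = 2 * (d ^ (m + 1) * (‖z‖ ^ k * ‖Rz z * Rz 1 ^ k‖) +
            d ^ (m + 1) * (‖z‖ ^ k * ‖Rz 1 ^ (k + 1)‖)) := by ring
      _ ≤ 2 * (C * ‖z‖ ^ (2 * m + 1 + n) +
            (2 * ‖z‖ ^ 2) ^ (m + 1) * (‖z‖ ^ k * ‖Rz 1 ^ (k + 1)‖)) := by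
          gcongr 2 * (?_ + ?_ * _)
          · exact h z hz
          · gcongr
      _ = 2 * (C * ‖z‖ ^ (2 * m + 1 + n) +
            2 ^ (m + 1) * ‖Rz 1 ^ (k + 1)‖ * ‖z‖ ^ (2 * m + 2 + k)) := by ring
      _ ≤ 2 * (C * ‖z‖ ^ (2 * m + 1 + n) +
            2 ^ (m + 1) * ‖Rz 1 ^ (k + 1)‖ * ‖z‖ ^ (2 * m + 1 + n)) := by
          gcongr ?_ * (_ + _ * ?_)
          exact pow_le_pow_right₀ (by linarith) (by omega)
      _ = _ := by ring

/-- The resolvent of the generator of an integrated group, damped on the imaginary axis. -/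
theorem Generates.damped_resolvent_le {n m : ℕ} {M : ℝ} (hM : 0 < M) {Sp Sm : ℝ → G →L[ℂ] G}
    (hgen : Generates A n m M Sp Sm) (hR : ResolventAt A z R) :
    ‖z ^ 2 + (‖z‖ : ℂ) ^ 2‖ ^ (m + 1) * ‖R‖ ≤
      2 ^ (m + 1) * M * m.factorial * ‖z‖ ^ (m + 1 + n) * (1 + ‖z‖ ^ m) := by
  obtain ⟨-, -, hSp, hSm, hres⟩ := hgen
  rcases eq_or_ne z.re 0 with h0 | h0
  · rw [norm_sq_add_norm_sq, h0]
    simp only [abs_zero, mul_zero, ne_eq, Nat.succ_ne_zero, not_false_eq_true, zero_pow, zero_mul]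
    positivity
  have hpos : 0 < |z.re| := abs_pos.2 h0
  have hRle : ‖R‖ ≤ ‖z‖ ^ n * (M * (1 / |z.re| + m.factorial / |z.re| ^ (m + 1)) * 1) := by
    refine ContinuousLinearMap.opNorm_le_bound _ (by positivity) fun x => ?_
    rcases lt_or_gt_of_ne h0 with hneg | hp
    · have hz' : 0 < (-z).re := by simpa using hneg
      obtain ⟨-, S, hS, hSx⟩ := hres (-z) hz'
      rw [neg_neg] at hS
      rw [hR.unique hS, ← norm_neg, hSx, norm_smul, norm_pow, norm_neg, abs_of_neg hneg,
        mul_assoc, mul_one]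
      gcongr
      simpa using norm_laplace_le hSm hz' x
    · obtain ⟨⟨S, hS, hSx⟩, -⟩ := hres z hp
      rw [hR.unique hS, hSx, norm_smul, norm_pow, abs_of_pos hp, mul_assoc, mul_one]
      gcongr
      exact norm_laplace_le hSp hp x
  simpa using norm_damp_mul_le hM zero_le_one hpos hRle

end Resolvent

theorem powApply_eq_zero_of_spectrumSet_eq [CompleteSpace G] {A : G →ₗ.[ℂ] G} {n m : ℕ}
    (hnm : n ≤ m) {M : ℝ} (hM : 0 < M) {Sp Sm : ℝ → G →L[ℂ] G} (hgen : Generates A n m M Sp Sm)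
    (hσ : spectrumSet A = {0}) (x : G) (hx : InDomPow A (m - n + 1) x) :
    powApply A (m - n + 1) x hx = 0 := by
  have hres : ∀ z : ℂ, ∃ R : G →L[ℂ] G, z ≠ 0 → ResolventAt A z R := by
    intro z
    by_cases hz : z = 0
    · exact ⟨0, fun h => absurd hz h⟩
    · have : z ∈ resolventSet A := by
        by_contra h
        exact hz (by simpa [hσ] using (show z ∈ spectrumSet A from h))
      obtain ⟨R, hR⟩ := this
      exact ⟨R, fun _ => hR⟩
  choose Rz hRz using hres
  set y := powApply A (m - n + 1) x hx
  set K : ℝ := 2 ^ (m + 1) * M * m.factorial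
  have hK0 : 0 ≤ K := by positivity
  have hb : ∀ z : ℂ, z ≠ 0 → ‖z ^ 2 + (‖z‖ : ℂ) ^ 2‖ ^ (m + 1) * ‖Rz z‖ ≤
      K * ‖z‖ ^ (m + 1 + n) * (1 + ‖z‖ ^ m) :=
    fun z hz => hgen.damped_resolvent_le hM (hRz z hz)
  have hbinf : ∀ z : ℂ, 2 ≤ ‖z‖ → ‖z ^ 2 + (‖z‖ : ℂ) ^ 2‖ ^ (m + 1) * ‖Rz z‖ ≤
      2 * K * ‖z‖ ^ (2 * m + 1 + n) := by
    intro z hz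
    have hz0 : z ≠ 0 := by rintro rfl; norm_num at hz
    refine (hb z hz0).trans ?_
    have h1 : 1 ≤ ‖z‖ ^ m := one_le_pow₀ (by linarith)
    calc K * ‖z‖ ^ (m + 1 + n) * (1 + ‖z‖ ^ m)
        ≤ K * ‖z‖ ^ (m + 1 + n) * (‖z‖ ^ m + ‖z‖ ^ m) := by gcongr
      _ = _ := by ring
  obtain ⟨C₁, hC₁, h₁⟩ :=
    exists_damped_resolvent_mul_pow_le hRz (by positivity : 0 ≤ 2 * K) hbinf n le_rfl
  obtain ⟨C₂, hC₂, h₂⟩ := exists_norm_resolvent_powApply_le hRz (m - n + 1) x hx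
  set B := Rz 1
  set C₀ : ℝ := ‖B ^ n‖ * (2 ^ (m + 1) * C₂ + 2 * K * ‖x‖)
  have hzero : Rz 1 ((B ^ n) y) = 0 := by
    refine eq_zero_of_damped_bounds (g := fun z => Rz z ((B ^ n) y)) ?_ (m + 1)
      (C := max C₀ (C₁ * ‖y‖)) ?_ ?_ one_ne_zero
    · intro z hz
      exact (ResolventAt.differentiableAt isOpen_ne (s := {z : ℂ | z ≠ 0}) hRz hz).clm_apply
        (differentiableAt_const _)
    · intro z hz hz1
      have hcomm : Rz z ((B ^ n) y) = (B ^ n) (Rz z y) := by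
        rw [← mul_apply_eq_comp, ← mul_apply_eq_comp,
          (((hRz z hz).commute (hRz 1 one_ne_zero)).pow_right n).eq]
      have hRy : ‖Rz z y‖ ≤ C₂ + ‖z‖ ^ (m - n + 1) * (‖Rz z‖ * ‖x‖) := by
        have h := norm_le_norm_sub_add (Rz z y) (z ^ (m - n + 1) • Rz z x)
        rw [norm_smul, norm_pow] at h
        refine h.trans (add_le_add (h₂ z hz hz1) ?_)
        gcongr
        exact (Rz z).le_opNorm x
      have hd2 := norm_sq_add_norm_sq_le z
      have hbz := hb z hz
      set d := ‖z ^ 2 + (‖z‖ : ℂ) ^ 2‖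
      have hzm : ‖z‖ ^ m ≤ 1 := pow_le_one₀ (norm_nonneg _) hz1
      calc d ^ (m + 1) * ‖Rz z ((B ^ n) y)‖
          ≤ d ^ (m + 1) * (‖B ^ n‖ * (C₂ + ‖z‖ ^ (m - n + 1) * (‖Rz z‖ * ‖x‖))) := by
            rw [hcomm]
            gcongr
            exact ((B ^ n).le_opNorm _).trans (by gcongr)
        _ = ‖B ^ n‖ * (d ^ (m + 1) * C₂ +
              ‖z‖ ^ (m - n + 1) * (d ^ (m + 1) * ‖Rz z‖) * ‖x‖) := by ring
        _ ≤ ‖B ^ n‖ * ((2 * ‖z‖ ^ 2) ^ (m + 1) * C₂ +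
              ‖z‖ ^ (m - n + 1) * (K * ‖z‖ ^ (m + 1 + n) * (1 + 1)) * ‖x‖) := by
            gcongr ‖B ^ n‖ * (?_ * C₂ + _ * ?_ * _)
            · gcongr
            · exact hbz.trans (by gcongr)
        _ = ‖B ^ n‖ * ((2 * ‖z‖ ^ 2) ^ (m + 1) * C₂ +
              2 * K * ‖x‖ * ‖z‖ ^ (m - n + 1 + (m + 1 + n))) := by ring
        _ = C₀ * ‖z‖ ^ (2 * (m + 1)) := by
            rw [show m - n + 1 + (m + 1 + n) = 2 * (m + 1) by omega, mul_pow, ← pow_mul]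
            ring
        _ ≤ _ := by gcongr; exact le_max_left _ _
    · intro z hz
      have h := h₁ z hz
      set d := ‖z ^ 2 + (‖z‖ : ℂ) ^ 2‖
      have hzpos : 0 < ‖z‖ := by linarith
      refine le_of_mul_le_mul_left ?_ (pow_pos hzpos n)
      calc ‖z‖ ^ n * (d ^ (m + 1) * (‖z‖ * ‖Rz z ((B ^ n) y)‖))
          ≤ ‖z‖ ^ n * (d ^ (m + 1) * (‖z‖ * (‖Rz z * B ^ n‖ * ‖y‖))) := by
            gcongr
            exact (Rz z * B ^ n).le_opNorm y
        _ = d ^ (m + 1) * (‖z‖ ^ n * ‖Rz z * B ^ n‖) * (‖z‖ * ‖y‖) := by ring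
        _ ≤ C₁ * ‖z‖ ^ (2 * m + 1 + n) * (‖z‖ * ‖y‖) := by gcongr
        _ = ‖z‖ ^ n * (C₁ * ‖y‖ * ‖z‖ ^ (2 * (m + 1))) := by ring
        _ ≤ _ := by gcongr; exact le_max_right _ _
  have hinj := (hRz 1 one_ne_zero).injective
  have hpow : (B ^ (n + 1)) y = 0 := by rw [pow_succ']; exact hzero
  refine hinj.iterate (n + 1) ?_
  rw [← FunLike.coe_pow_eq_iterate, hpow, map_zero]

theorem spectrumSet_eq_of_powApply_eq_zero [Nontrivial G] {A : G →ₗ.[ℂ] G}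
    {B : G →L[ℂ] G} (hB : ResolventAt A 1 B) {j : ℕ}
    (hA : ∀ (x : G) (hx : InDomPow A j x), powApply A j x hx = 0) :
    spectrumSet A = {0} := by
  have hnil : IsNilpotent (B - 1) := by
    refine ⟨j, ContinuousLinearMap.ext fun x => ?_⟩
    obtain ⟨h, hp⟩ := hB.exists_powApply_pow j x _ rfl
    rw [← hp, hA]
    rfl
  obtain ⟨U, hU⟩ : IsUnit B := by simpa using hnil.isUnit_one_add
  have hBV : B * (↑U⁻¹ : G →L[ℂ] G) = 1 := by rw [← hU]; exact U.mul_inv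
  have hVB : (↑U⁻¹ : G →L[ℂ] G) * B = 1 := by rw [← hU]; exact U.inv_mul
  set V : G →L[ℂ] G := ↑U⁻¹
  have hBVx : ∀ x, B (V x) = x := fun x => DFunLike.congr_fun hBV x
  have hVBx : ∀ x, V (B x) = x := fun x => DFunLike.congr_fun hVB x
  set T : G →L[ℂ] G := 1 - V with hT
  have hTV : T = (B - 1) * V := by rw [sub_mul, hBV, one_mul]
  have hBV' : Commute B V := by rw [Commute, SemiconjBy, hBV, hVB]
  have hTnil : IsNilpotent T := by
    rw [hTV]
    exact (hBV'.sub_left (Commute.one_left V)).isNilpotent_mul_right hnil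
  have hdom : ∀ x, x ∈ A.domain := fun x => hBVx x ▸ hB.mem (V x)
  have hAT : ∀ (x : G) (hx : x ∈ A.domain), A ⟨x, hx⟩ = T x := by
    intro x hx
    have h := hB.apply_eq (V x)
    simp only [hBVx, one_smul] at h
    rw [h]
    simp [hT]
  ext z
  simp only [spectrumSet, Set.mem_compl_iff, Set.mem_singleton_iff, not_iff_comm (b := z = 0)]
  constructor
  · intro hz
    have hunit : IsUnit (algebraMap ℂ (G →L[ℂ] G) z - T) := by
      rw [sub_eq_add_neg]
      exact IsNilpotent.isUnit_add_left_of_commute hTnil.neg ((IsUnit.mk0 z hz).map _)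
        (Algebra.commutes z _).symm
    obtain ⟨W, hW⟩ := hunit
    refine ⟨(↑W⁻¹ : G →L[ℂ] G), fun y => hdom _, fun y => ?_, fun x => ?_⟩
    · rw [hAT]
      have := DFunLike.congr_fun W.mul_inv y
      rw [hW] at this
      simpa [Algebra.algebraMap_eq_smul_one] using this
    · rw [hAT]
      have := DFunLike.congr_fun W.inv_mul (x : G)
      rw [hW] at this
      simpa [Algebra.algebraMap_eq_smul_one] using this
  · rintro ⟨R, hR⟩ rfl
    have h1 : T * (-R) = 1 := by
      ext y
      have := hR.solves y
      rw [hAT] at this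
      simpa using this
    have h2 : (-R) * T = 1 := by
      ext x
      have := hR.leftInv ⟨x, hdom x⟩
      rw [hAT] at this
      simpa using this
    obtain ⟨k, hk⟩ := hTnil
    have : IsUnit (T ^ k) := IsUnit.pow k ⟨⟨T, -R, h1, h2⟩, rfl⟩
    rw [hk] at this
    exact not_isUnit_zero this

/-- Gelfand-type theorem for integrated groups: if `E ≠ {0}` and the closed
densely defined operator `A` generates an `n`-times integrated group bounded by
`M (1 + |t| ^ m)` with `m ≥ n`, then `σ(A) = {0}` if and only if
`A ^ (m - n + 1) x = 0` for every `x ∈ D(A ^ (m - n + 1))`. -/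
theorem gelfand_integrated_group
    {E : Type*} [NormedAddCommGroup E] [NormedSpace ℂ E] [CompleteSpace E]
    [Nontrivial E]
    (A : E →ₗ.[ℂ] E)
    (hAclosed : IsClosed (A.graph : Set (E × E)))
    (hAdense : Dense (A.domain : Set E))
    (n m : ℕ) (hnm : n ≤ m) (M : ℝ) (hM : 0 < M)
    (Sp Sm : ℝ → E →L[ℂ] E) (hgen : Generates A n m M Sp Sm) :
    spectrumSet A = {0} ↔
      ∀ (x : E) (hx : InDomPow A (m - n + 1) x), powApply A (m - n + 1) x hx = 0 := by
  refine ⟨fun h => powApply_eq_zero_of_spectrumSet_eq hnm hM hgen h, fun h => ?_⟩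
  obtain ⟨⟨B, hB, -⟩, -⟩ := hgen.2.2.2.2 1 (by simp)
  exact spectrumSet_eq_of_powApply_eq_zero hB h

end SpectralDecomp
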